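/- Let (X,d) be a complete separable metric space in which closed balls are compact, let α be a Young function satisfying the Δ₂-condition, and let μ be a probability measure on X. If μ satisfies the modified log-Sobolev inequality minus LSI⁻_α(A) for some A > 0, then μ satisfies the transport-entropy inequality T_α(C⁻) with C⁻ = (1+(p_α−1)A)^{p_α−r_α} · ((p_α−1)A)^{r_α−1}. -/

import Mathlib

open MeasureTheory Filter Set Topology
open scoped ENNReal NNReal

noncomputable section

/-- The right derivative of a function `α : ℝ → ℝ`. -/
def rightD (α : ℝ → ℝ) (x : ℝ) : ℝ := derivWithin α (Set.Ioi x) x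

/-- The left derivative of a function `α : ℝ → ℝ`. -/
def leftD (α : ℝ → ℝ) (x : ℝ) : ℝ := derivWithin α (Set.Iio x) x

/-- A Young function: an even, convex, nonnegative function, increasing on `[0,∞)`,
vanishing at `0` and with vanishing right derivative at `0`. -/
structure IsYoung (α : ℝ → ℝ) : Prop where
  nonneg : ∀ x, 0 ≤ α x
  even : ∀ x, α (-x) = α x
  convex : ConvexOn ℝ Set.univ α
  mono : StrictMonoOn α (Set.Ici 0)
  zero : α 0 = 0
  rightD_zero : rightD α 0 = 0

/-- The Δ₂-condition for a Young function. -/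
def DeltaTwo (α : ℝ → ℝ) : Prop := ∃ K > 0, ∀ x : ℝ, α (2 * x) ≤ K * α x

/-- `r_α = inf_{x>0} x α'₋(x)/α(x)`. -/
def rAlpha (α : ℝ → ℝ) : ℝ := sInf {r : ℝ | ∃ x > 0, r = x * leftD α x / α x}

/-- `p_α = sup_{x>0} x α'₊(x)/α(x)`. -/
def pAlpha (α : ℝ → ℝ) : ℝ := sSup {r : ℝ | ∃ x > 0, r = x * rightD α x / α x}

/-- The Fenchel-Legendre transform `α*(y) = sup_x {xy - α(x)}`, with values in `[0,∞]`. -/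
def legendre (α : ℝ → ℝ) (y : ℝ) : ℝ≥0∞ := ⨆ x : ℝ, ENNReal.ofReal (x * y - α x)

/-- `ξ_α(t) = sup_{u>0} α*(t α'₊(u)) / (t α(u))`. -/
def xiAlpha (α : ℝ → ℝ) (t : ℝ) : ℝ≥0∞ :=
  ⨆ u : {u : ℝ // 0 < u}, legendre α (t * rightD α u) / ENNReal.ofReal (t * α u)

/-- A bounded real-valued function. -/
def IsBoundedFun {Y : Type*} (f : Y → ℝ) : Prop := ∃ M, ∀ x, |f x| ≤ M

variable {X : Type*} [MetricSpace X] [MeasurableSpace X]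

/-- The optimal transport cost `T_α(ν,μ)` between two measures, for the cost
function `(x,y) ↦ α(d(x,y))`. -/
def transportCost (α : ℝ → ℝ) (ν μ : Measure X) : ℝ≥0∞ :=
  sInf { c : ℝ≥0∞ | ∃ π : Measure (X × X), π.map Prod.fst = ν ∧ π.map Prod.snd = μ ∧
      c = ∫⁻ z, ENNReal.ofReal (α (dist z.1 z.2)) ∂π }

open Classical in
/-- The relative entropy `H(ν|μ) = ∫ log (dν/dμ) dν` if `ν ≪ μ` (and `+∞` if `ν` is not
absolutely continuous with respect to `μ`, or if the integral diverges). -/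
def relEnt (ν μ : Measure X) : ℝ≥0∞ :=
  if ν ≪ μ ∧ Integrable (fun x => Real.log (ν.rnDeriv μ x).toReal) ν
  then ENNReal.ofReal (∫ x, Real.log (ν.rnDeriv μ x).toReal ∂ν) else ⊤

/-- The transport-entropy inequality `T_α(C)`: for every probability measure `ν`,
`T_α(ν,μ) ≤ C H(ν|μ)`. -/
def TransportEntropy (μ : Measure X) (α : ℝ → ℝ) (C : ℝ) : Prop :=
  ∀ ν : Measure X, IsProbabilityMeasure ν →
    transportCost α ν μ ≤ ENNReal.ofReal C * relEnt ν μ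

/-- The entropy functional `Ent_μ(e^f)`. -/
def entExp (μ : Measure X) (f : X → ℝ) : ℝ :=
  ∫ x, Real.exp (f x) * Real.log (Real.exp (f x)) ∂μ
    - (∫ x, Real.exp (f x) ∂μ) * Real.log (∫ x, Real.exp (f x) ∂μ)

/-- `|∇⁺ f|(x) = limsup_{y → x} [f(y) - f(x)]₊ / d(y,x)` (equal to `0` at isolated
points by the conventions on `limsup` and `sInf` in `ℝ`). -/
def gradPlus (f : X → ℝ) (x : X) : ℝ :=
  limsup (fun y => max (f y - f x) 0 / dist y x) (𝓝[≠] x)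

/-- `|∇⁻ f|(x) = limsup_{y → x} [f(y) - f(x)]₋ / d(y,x)` (equal to `0` at isolated
points by the conventions on `limsup` and `sInf` in `ℝ`). -/
def gradMinus (f : X → ℝ) (x : X) : ℝ :=
  limsup (fun y => max (-(f y - f x)) 0 / dist y x) (𝓝[≠] x)

/-- The modified log-Sobolev inequality plus `LSI⁺_α(A)`. -/
def LSIplus (μ : Measure X) (α : ℝ → ℝ) (A : ℝ) : Prop :=
  ∀ f : X → ℝ, IsBoundedFun f → LocallyLipschitz f →
    ENNReal.ofReal (entExp μ f) ≤
      ENNReal.ofReal A * ∫⁻ x, legendre α (gradPlus f x) * ENNReal.ofReal (Real.exp (f x)) ∂μ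

/-- The modified log-Sobolev inequality minus `LSI⁻_α(A)`. -/
def LSIminus (μ : Measure X) (α : ℝ → ℝ) (A : ℝ) : Prop :=
  ∀ f : X → ℝ, IsBoundedFun f → LocallyLipschitz f →
    ENNReal.ofReal (entExp μ f) ≤
      ENNReal.ofReal A * ∫⁻ x, legendre α (gradMinus f x) * ENNReal.ofReal (Real.exp (f x)) ∂μ

/-- The inf-convolution operator `Q_α^λ f(x) = inf_y {f(y) + λ α(d(x,y))}`. -/
def QInf (α : ℝ → ℝ) (lam : ℝ) (f : X → ℝ) (x : X) : ℝ :=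
  ⨅ y : X, (f y + lam * α (dist x y))

/-- The `(τ)`-log-Sobolev inequality `(τ)-LSI_α(λ, A)`. -/
def TauLSI (μ : Measure X) (α : ℝ → ℝ) (lam A : ℝ) : Prop :=
  ∀ f : X → ℝ, IsBoundedFun f → LocallyLipschitz f →
    entExp μ f ≤ A * ∫ x, (f x - QInf α lam f x) * Real.exp (f x) ∂μ

/-- The `n`-dimensional inf-convolution operator
`Q_{α,n} f(x) = inf_y {f(y) + Σᵢ α(d(xᵢ,yᵢ))}`. -/
def QInfN (α : ℝ → ℝ) {n : ℕ} (f : (Fin n → X) → ℝ) (x : Fin n → X) : ℝ :=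
  ⨅ y : Fin n → X, (f y + ∑ i, α (dist (x i) (y i)))

/-- The `n`-dimensional sup-convolution operator
`P_{α,n} f(x) = sup_y {f(y) - Σᵢ α(d(xᵢ,yᵢ))}`. -/
def PSupN (α : ℝ → ℝ) {n : ℕ} (f : (Fin n → X) → ℝ) (x : Fin n → X) : ℝ :=
  ⨆ y : Fin n → X, (f y - ∑ i, α (dist (x i) (y i)))

end


namespace IsYoung

variable {α : ℝ → ℝ}

theorem continuous (hα : IsYoung α) : Continuous α :=
  continuousOn_univ.1 (hα.convex.continuousOn isOpen_univ)

theorem pos (hα : IsYoung α) {x : ℝ} (hx : 0 < x) : 0 < α x := by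
  simpa [hα.zero] using hα.mono self_mem_Ici hx.le hx

theorem hasDerivWithinAt_rightD (hα : IsYoung α) (x : ℝ) :
    HasDerivWithinAt α (rightD α x) (Ioi x) x :=
  hα.convex.hasDerivWithinAt_rightDeriv_of_mem_interior (by simp)

theorem leftD_le_rightD (hα : IsYoung α) (x : ℝ) : leftD α x ≤ rightD α x :=
  hα.convex.leftDeriv_le_rightDeriv_of_mem_interior (by simp)

theorem monotone_rightD (hα : IsYoung α) : Monotone (rightD α) := fun x y h =>
  hα.convex.monotoneOn_rightDeriv (by simp) (by simp) h

theorem rightD_nonneg (hα : IsYoung α) {x : ℝ} (hx : 0 ≤ x) : 0 ≤ rightD α x := by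
  simpa [hα.rightD_zero] using hα.monotone_rightD hx

theorem leftD_tangent_le (hα : IsYoung α) {u x : ℝ} (h : x ≤ u) :
    α u + leftD α u * (x - u) ≤ α x := by
  rcases h.eq_or_lt with rfl | h
  · simp
  have := hα.convex.slope_le_leftDeriv_of_mem_interior (mem_univ x) (by simp : u ∈ _) h
  rw [slope_def_field, div_le_iff₀ (by linarith)] at this
  change _ ≤ leftD α u * _ at this
  linarith

theorem rightD_tangent_le (hα : IsYoung α) (u x : ℝ) : α u + rightD α u * (x - u) ≤ α x := by
  rcases lt_or_ge u x with h | h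
  · have := hα.convex.rightDeriv_le_slope_of_mem_interior (by simp : u ∈ _) (mem_univ x) h
    rw [slope_def_field, le_div_iff₀ (by linarith)] at this
    change rightD α u * _ ≤ _ at this
    linarith
  · have := hα.leftD_tangent_le h
    nlinarith [hα.leftD_le_rightD u]

/-- Increments of `α` over an interval contained in `[0, v]` are controlled by `α'₊(v)`. -/
theorem sub_le_rightD_mul (hα : IsYoung α) {a b v δ : ℝ} (hb : 0 ≤ b) (ha : 0 ≤ a) (hav : a ≤ v)
    (hab : a ≤ b + δ) (hδ : 0 ≤ δ) : α a - α b ≤ rightD α v * δ := by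
  have hv : 0 ≤ rightD α v := hα.rightD_nonneg (ha.trans hav)
  rcases le_total a b with h | h
  · have := hα.mono.monotoneOn ha hb h
    nlinarith [mul_nonneg hv hδ]
  · have h1 := hα.rightD_tangent_le a b
    have h2 := hα.monotone_rightD hav
    nlinarith [mul_le_mul_of_nonneg_right h2 (sub_nonneg.2 h),
      mul_le_mul_of_nonneg_left (show a - b ≤ δ by linarith) hv]

theorem mul_rightD_le (hα : IsYoung α) (hΔ : DeltaTwo α) {x : ℝ} (hx : 0 < x) :
    x * rightD α x ≤ pAlpha α * α x := by
  obtain ⟨K, -, hK⟩ := hΔ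
  have hbdd : BddAbove {r : ℝ | ∃ x > 0, r = x * rightD α x / α x} := by
    refine ⟨K - 1, ?_⟩
    rintro _ ⟨y, hy, rfl⟩
    rw [div_le_iff₀ (hα.pos hy)]
    have := hα.rightD_tangent_le y (2 * y)
    linarith [hK y]
  rw [← div_le_iff₀ (hα.pos hx)]
  exact le_csSup hbdd ⟨x, hx, rfl⟩

theorem rAlpha_mul_le_leftD (hα : IsYoung α) {x : ℝ} (hx : 0 < x) :
    rAlpha α * α x ≤ x * leftD α x := by
  have hbdd : BddBelow {r : ℝ | ∃ x > 0, r = x * leftD α x / α x} := by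
    refine ⟨1, ?_⟩
    rintro _ ⟨y, hy, rfl⟩
    rw [le_div_iff₀ (hα.pos hy)]
    have := hα.leftD_tangent_le hy.le
    rw [hα.zero] at this
    linarith
  rw [← le_div_iff₀ (hα.pos hx)]
  exact csInf_le hbdd ⟨x, hx, rfl⟩

theorem rAlpha_mul_le (hα : IsYoung α) {x : ℝ} (hx : 0 < x) :
    rAlpha α * α x ≤ x * rightD α x :=
  (hα.rAlpha_mul_le_leftD hx).trans (mul_le_mul_of_nonneg_left (hα.leftD_le_rightD x) hx.le)

theorem rAlpha_le_pAlpha (hα : IsYoung α) (hΔ : DeltaTwo α) : rAlpha α ≤ pAlpha α :=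
  le_of_mul_le_mul_right ((hα.rAlpha_mul_le one_pos).trans (hα.mul_rightD_le hΔ one_pos))
    (hα.pos one_pos)

theorem hasDerivWithinAt_mul_rpow (hα : IsYoung α) (e : ℝ) {x : ℝ} (hx : 0 < x) :
    HasDerivWithinAt (fun x => α x * x ^ (-e))
      (x ^ (-e - 1) * (x * rightD α x - e * α x)) (Ici x) x := by
  have h := (hα.hasDerivWithinAt_rightD x).Ici_of_Ioi.mul
    (Real.hasDerivAt_rpow_const (p := -e) (Or.inl hx.ne')).hasDerivWithinAt
  refine h.congr_deriv ?_
  rw [show x ^ (-e) = x ^ (-e - 1) * x by rw [← Real.rpow_add_one hx.ne']; ring_nf]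
  ring

theorem continuousOn_mul_rpow (hα : IsYoung α) (e : ℝ) {a b : ℝ} (ha : 0 < a) :
    ContinuousOn (fun x => α x * x ^ (-e)) (Icc a b) :=
  hα.continuous.continuousOn.mul fun _ hx =>
    (Real.continuousAt_rpow_const _ _ (Or.inl (ha.trans_le hx.1).ne')).continuousWithinAt

theorem rpow_mul_le_of_le_one (hα : IsYoung α) {p : ℝ}
    (hp : ∀ x > 0, x * rightD α x ≤ p * α x) {v z : ℝ} (hv : 0 < v) (hv1 : v ≤ 1) (hz : 0 < z) :
    v ^ p * α z ≤ α (v * z) := by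
  have hvz : 0 < v * z := mul_pos hv hz
  have hle : v * z ≤ z := by nlinarith
  have key := image_le_of_deriv_right_le_deriv_boundary (hα.continuousOn_mul_rpow p hvz)
    (fun x hx => hα.hasDerivWithinAt_mul_rpow p (hvz.trans_le hx.1))
    (B := fun _ => α (v * z) * (v * z) ^ (-p)) (B' := fun _ => 0) le_rfl
    continuousOn_const (fun x _ => hasDerivWithinAt_const _ _ _)
    (fun x hx => mul_nonpos_of_nonneg_of_nonpos
      (Real.rpow_nonneg (hvz.trans_le hx.1).le _)
      (by linarith [hp x (hvz.trans_le hx.1)])) (right_mem_Icc.2 hle)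
  simp only [Real.mul_rpow hv.le hz.le, Real.rpow_neg hv.le] at key
  have h1 : 0 < z ^ (-p) := Real.rpow_pos_of_pos hz _
  have h2 : 0 < v ^ p := Real.rpow_pos_of_pos hv _
  rw [← mul_assoc] at key
  have := le_of_mul_le_mul_right key h1
  rwa [← div_eq_mul_inv, le_div_iff₀ h2, mul_comm] at this

theorem rpow_mul_le_of_one_le (hα : IsYoung α) {r : ℝ}
    (hr : ∀ x > 0, r * α x ≤ x * rightD α x) {v z : ℝ} (hv1 : 1 ≤ v) (hz : 0 < z) :
    v ^ r * α z ≤ α (v * z) := by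
  have hv : 0 < v := one_pos.trans_le hv1
  have hle : z ≤ v * z := by nlinarith
  have key := image_le_of_deriv_right_le_deriv_boundary (f := fun _ => α z * z ^ (-r))
    (f' := fun _ => 0) (B := fun x => α x * x ^ (-r)) (a := z) continuousOn_const
    (fun x _ => hasDerivWithinAt_const _ _ _) le_rfl
    (hα.continuousOn_mul_rpow r hz)
    (fun x hx => hα.hasDerivWithinAt_mul_rpow r (hz.trans_le hx.1))
    (fun x hx => mul_nonneg (Real.rpow_nonneg (hz.trans_le hx.1).le _)
      (by linarith [hr x (hz.trans_le hx.1)])) (right_mem_Icc.2 hle)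
  simp only [Real.mul_rpow hv.le hz.le, Real.rpow_neg hv.le] at key
  have h1 : 0 < z ^ (-r) := Real.rpow_pos_of_pos hz _
  have h2 : 0 < v ^ r := Real.rpow_pos_of_pos hv _
  rw [← mul_assoc] at key
  have := le_of_mul_le_mul_right key h1
  rwa [← div_eq_mul_inv, le_div_iff₀ h2, mul_comm] at this

theorem one_lt_pAlpha (hα : IsYoung α) (hΔ : DeltaTwo α) : 1 < pAlpha α := by
  by_contra! hp
  have hlin : ∀ v ∈ Ioc (0 : ℝ) 1, α 1 ≤ slope α 0 v := fun v hv => by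
    have := hα.rpow_mul_le_of_le_one (p := 1) (fun x hx => (hα.mul_rightD_le hΔ hx).trans
      (mul_le_mul_of_nonneg_right hp (hα.nonneg x))) hv.1 hv.2 one_pos
    rw [slope_def_field, hα.zero, le_div_iff₀ (by linarith [hv.1])]
    simpa [mul_comm] using this
  have hlim := (hasDerivWithinAt_iff_tendsto_slope' self_notMem_Ioi).1
    (hα.hasDerivWithinAt_rightD 0)
  rw [hα.rightD_zero] at hlim
  have : α 1 ≤ 0 := ge_of_tendsto hlim <| by
    filter_upwards [Ioc_mem_nhdsGT (zero_lt_one' ℝ)] with v hv using hlin v hv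
  exact absurd (hα.pos one_pos) this.not_gt

/-- If `α(v z) ≥ vᵉ α(z)`, then `α*(vᵉ⁻¹ α'₊(u)) ≤ vᵉ (p_α - 1) α(u)`. -/
theorem mul_sub_le_of_rpow_mul_le (hα : IsYoung α) (hΔ : DeltaTwo α) {e v : ℝ} (hv : 0 < v)
    (he : ∀ z > 0, v ^ e * α z ≤ α (v * z)) {u : ℝ} (hu : 0 < u) (x : ℝ) :
    x * (v ^ (e - 1) * rightD α u) - α x ≤ v ^ e * ((pAlpha α - 1) * α u) := by
  have hpu : 0 ≤ (pAlpha α - 1) * α u :=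
    mul_nonneg (by linarith [hα.one_lt_pAlpha hΔ]) (hα.nonneg u)
  have hve : 0 < v ^ e := Real.rpow_pos_of_pos hv _
  rcases le_or_gt x 0 with hx | hx
  · have : x * (v ^ (e - 1) * rightD α u) ≤ 0 := mul_nonpos_of_nonpos_of_nonneg hx
      (mul_nonneg (Real.rpow_nonneg hv.le _) (hα.rightD_nonneg hu.le))
    have := mul_nonneg hve.le hpu
    linarith [hα.nonneg x]
  · have h1 := he (x / v) (div_pos hx hv)
    rw [mul_div_cancel₀ _ hv.ne'] at h1
    have h2 := hα.rightD_tangent_le u (x / v)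
    have h3 := hα.mul_rightD_le hΔ hu
    have h4 : x * (v ^ (e - 1) * rightD α u) = v ^ e * (rightD α u * (x / v)) := by
      rw [Real.rpow_sub_one hv.ne']; field_simp
    have h5 : rightD α u * (x / v) - α (x / v) ≤ (pAlpha α - 1) * α u := by linarith
    have := mul_le_mul_of_nonneg_left h5 hve.le
    rw [h4]
    linarith

/-- A scale `s` at which `α*` is compatible with the constant `A`, and whose inverse is controlled
by the constant of the transport-entropy inequality. -/
theorem exists_scale (hα : IsYoung α) (hΔ : DeltaTwo α) {A : ℝ} (hA : 0 < A) :
    ∃ s > 0, (∀ u > 0, ∀ x, A * (x * (s * rightD α u) - α x) ≤ s * α u) ∧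
      s⁻¹ ≤ (1 + (pAlpha α - 1) * A) ^ (pAlpha α - rAlpha α) *
        ((pAlpha α - 1) * A) ^ (rAlpha α - 1) := by
  have hp := hα.one_lt_pAlpha hΔ
  have hrp := hα.rAlpha_le_pAlpha hΔ
  set B := (pAlpha α - 1) * A with hB
  have hB0 : 0 < B := mul_pos (by linarith) hA
  have hv : 0 < B⁻¹ := inv_pos.2 hB0
  have main : ∀ e : ℝ, (∀ z > 0, B⁻¹ ^ e * α z ≤ α (B⁻¹ * z)) →
      ∀ u > 0, ∀ x, A * (x * (B⁻¹ ^ (e - 1) * rightD α u) - α x) ≤ B⁻¹ ^ (e - 1) * α u := by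
    intro e he u hu x
    refine (mul_le_mul_of_nonneg_left
      (hα.mul_sub_le_of_rpow_mul_le hΔ hv he hu x) hA.le).trans_eq ?_
    rw [Real.rpow_sub_one hv.ne', div_inv_eq_mul, hB]
    ring
  have hinv : ∀ e : ℝ, (B⁻¹ ^ (e - 1))⁻¹ = B ^ (e - 1) := fun e => by
    rw [Real.inv_rpow hB0.le, inv_inv]
  have hBr : 0 ≤ B ^ (rAlpha α - 1) := Real.rpow_nonneg hB0.le _
  rcases le_total 1 B with h1 | h1
  · refine ⟨B⁻¹ ^ (pAlpha α - 1), Real.rpow_pos_of_pos hv _, main _ fun z hz =>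
      hα.rpow_mul_le_of_le_one (fun x hx => hα.mul_rightD_le hΔ hx) hv (inv_le_one_of_one_le₀ h1) hz,
      ?_⟩
    rw [hinv, show pAlpha α - 1 = (pAlpha α - rAlpha α) + (rAlpha α - 1) by ring,
      Real.rpow_add hB0]
    exact mul_le_mul_of_nonneg_right
      (Real.rpow_le_rpow hB0.le (by linarith) (by linarith)) hBr
  · refine ⟨B⁻¹ ^ (rAlpha α - 1), Real.rpow_pos_of_pos hv _, main _ fun z hz =>
      hα.rpow_mul_le_of_one_le (fun x hx => hα.rAlpha_mul_le hx) ((one_le_inv₀ hB0).2 h1) hz, ?_⟩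
    rw [hinv]
    exact le_mul_of_one_le_left hBr (Real.one_le_rpow (by linarith) (by linarith))

end IsYoung

namespace IsYoung

variable {α : ℝ → ℝ}

theorem tendsto_atTop (hα : IsYoung α) : Tendsto α atTop atTop := by
  have h1 : 0 < rightD α 1 := by
    have := hα.rightD_tangent_le 1 0
    rw [hα.zero] at this
    linarith [hα.pos one_pos]
  refine tendsto_atTop_mono (fun x => hα.rightD_tangent_le 1 x) ?_
  exact tendsto_atTop_add_const_left _ _
    ((tendsto_atTop_add_const_right _ (-1) tendsto_id).const_mul_atTop h1)

theorem exists_eq (hα : IsYoung α) {c : ℝ} (hc : 0 < c) : ∃ v > 0, α v = c := by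
  obtain ⟨R, hR0, hR⟩ := ((eventually_ge_atTop 0).and (hα.tendsto_atTop.eventually_ge_atTop c)).exists
  obtain ⟨v, hv, hvc⟩ := intermediate_value_Icc hR0 hα.continuous.continuousOn
    ⟨hα.zero.trans_le hc.le, hR⟩
  refine ⟨v, hv.1.lt_of_ne ?_, hvc⟩
  rintro rfl
  rw [hα.zero] at hvc
  exact hc.ne hvc

theorem mul_legendre_le (hα : IsYoung α) {A s y u : ℝ} (hA : 0 < A)
    (hscale : ∀ x, A * (x * (s * rightD α u) - α x) ≤ s * α u) (hy : 0 ≤ y)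
    (hyu : y ≤ s * rightD α u) :
    ENNReal.ofReal A * legendre α y ≤ ENNReal.ofReal (s * α u) := by
  rw [legendre, ENNReal.mul_iSup]
  refine iSup_le fun x => ?_
  rw [← ENNReal.ofReal_mul hA.le]
  rcases le_total x 0 with hx | hx
  · rw [ENNReal.ofReal_of_nonpos]
    · exact zero_le
    · exact mul_nonpos_of_nonneg_of_nonpos hA.le
        (by linarith [hα.nonneg x, mul_nonpos_of_nonpos_of_nonneg hx hy])
  · refine ENNReal.ofReal_le_ofReal (le_trans (mul_le_mul_of_nonneg_left ?_ hA.le) (hscale x))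
    linarith [mul_le_mul_of_nonneg_left hyu hx]

theorem legendre_zero (hα : IsYoung α) : legendre α 0 = 0 := by
  simp [legendre, hα.nonneg]

end IsYoung

section QInf

variable {X : Type*} [MetricSpace X] {α : ℝ → ℝ} {s M : ℝ} {g : X → ℝ}

theorem bddBelow_range_QInf (hα : IsYoung α) (hs : 0 ≤ s) (hg : ∀ y, |g y| ≤ M) (x : X) :
    BddBelow (range fun y => g y + s * α (dist x y)) := by
  refine ⟨-M, ?_⟩
  rintro _ ⟨y, rfl⟩
  have := mul_nonneg hs (hα.nonneg (dist x y))
  linarith [(abs_le.1 (hg y)).1]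

theorem QInf_le (hα : IsYoung α) (hs : 0 ≤ s) (hg : ∀ y, |g y| ≤ M) (x y : X) :
    QInf α s g x ≤ g y + s * α (dist x y) :=
  ciInf_le (bddBelow_range_QInf hα hs hg x) y

theorem QInf_le_self (hα : IsYoung α) (hs : 0 ≤ s) (hg : ∀ y, |g y| ≤ M) (x : X) :
    QInf α s g x ≤ g x := by
  simpa [hα.zero] using QInf_le hα hs hg x x

theorem le_QInf {x : X} {c : ℝ} (h : ∀ y, c ≤ g y + s * α (dist x y)) : c ≤ QInf α s g x :=
  haveI : Nonempty X := ⟨x⟩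
  le_ciInf h

theorem exists_lt_QInf_add (x : X) {δ : ℝ} (hδ : 0 < δ) :
    ∃ y, g y + s * α (dist x y) < QInf α s g x + δ :=
  haveI : Nonempty X := ⟨x⟩
  exists_lt_of_ciInf_lt (lt_add_of_pos_right _ hδ)

theorem abs_QInf_le (hα : IsYoung α) (hs : 0 ≤ s) (hg : ∀ y, |g y| ≤ M) (x : X) :
    |QInf α s g x| ≤ M := by
  refine abs_le.2 ⟨le_QInf fun y => ?_, ?_⟩
  · have := mul_nonneg hs (hα.nonneg (dist x y))
    linarith [(abs_le.1 (hg y)).1]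
  · exact (QInf_le_self hα hs hg x).trans (abs_le.1 (hg x)).2

theorem QInf_le_QInf_add (hα : IsYoung α) (hs : 0 ≤ s) (hg : ∀ y, |g y| ≤ M) {g' : X → ℝ} {c : ℝ}
    (h : ∀ y, g y ≤ g' y + c) (x : X) : QInf α s g x ≤ QInf α s g' x + c := by
  rw [← sub_le_iff_le_add]
  refine le_QInf fun y => ?_
  linarith [QInf_le hα hs hg x y, h y]

/-- For almost minimizing points `y'` at `x'`, the cost varies at a controlled rate when `x'` is
moved to a nearby point. -/
theorem exists_cost_sub_le (hα : IsYoung α) (hs : 0 < s) (hg : ∀ y, |g y| ≤ M) :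
    ∃ W, 0 ≤ W ∧ ∀ x x' y', dist x x' ≤ 1 → g y' + s * α (dist x' y') ≤ QInf α s g x' + 1 →
      α (dist x y') - α (dist x' y') ≤ W * dist x x' := by
  obtain ⟨R, hR0, hR⟩ := ((eventually_ge_atTop 0).and
    (hα.tendsto_atTop.eventually_ge_atTop ((2 * M + 1) / s))).exists
  refine ⟨rightD α (R + 1), hα.rightD_nonneg (by linarith), fun x x' y' hd hy => ?_⟩
  have h1 : α (dist x' y') ≤ α R := by
    refine le_trans ?_ hR
    rw [le_div_iff₀ hs]
    linarith [(abs_le.1 (hg y')).1, (abs_le.1 (abs_QInf_le hα hs.le hg x')).2]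
  have h2 : dist x' y' ≤ R := (hα.mono.le_iff_le dist_nonneg hR0).1 h1
  have h3 := dist_triangle x x' y'
  exact hα.sub_le_rightD_mul dist_nonneg dist_nonneg (by linarith) (by linarith) dist_nonneg

theorem exists_QInf_sub_le (hα : IsYoung α) (hs : 0 < s) (hg : ∀ y, |g y| ≤ M) :
    ∃ L, 0 ≤ L ∧ ∀ x x', dist x x' ≤ 1 → QInf α s g x - QInf α s g x' ≤ L * dist x x' := by
  obtain ⟨W, hW, h⟩ := exists_cost_sub_le hα hs hg
  refine ⟨s * W, mul_nonneg hs.le hW, fun x x' hd => le_of_forall_pos_le_add fun δ hδ => ?_⟩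
  obtain ⟨y', hy'⟩ := exists_lt_QInf_add (α := α) (s := s) (g := g) x' (lt_min hδ one_pos)
  have h1 := h x x' y' hd (hy'.le.trans (by linarith [min_le_right δ 1]))
  have h2 := QInf_le hα hs.le hg x y'
  have h3 := mul_le_mul_of_nonneg_left h1 hs.le
  linarith [min_le_left δ 1]

theorem locallyLipschitz_QInf (hα : IsYoung α) (hs : 0 < s) (hg : ∀ y, |g y| ≤ M) :
    LocallyLipschitz (QInf α s g) := by
  obtain ⟨L, hL, h⟩ := exists_QInf_sub_le hα hs hg
  refine fun x => ⟨L.toNNReal, Metric.ball x (1 / 2), Metric.ball_mem_nhds x (by norm_num), ?_⟩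
  refine LipschitzOnWith.of_dist_le_mul fun a ha b hb => ?_
  have hab : dist a b ≤ 1 := by
    have := dist_triangle_right a b x
    rw [Metric.mem_ball] at ha hb
    linarith
  rw [Real.dist_eq, Real.coe_toNNReal _ hL, abs_le]
  constructor
  · have := h b a (by rwa [dist_comm])
    rw [dist_comm b a] at this
    linarith
  · exact h a b hab

theorem mul_QInf_add_le (hα : IsYoung α) (hs : 0 < s) {f : X → ℝ} (hf : ∀ y, |f y| ≤ M) {k h : ℝ}
    (hk : 0 < k) (hh : 0 ≤ h) (x : X) :
    k * QInf α s (fun y => (k + h) * f y) x ≤ (k + h) * QInf α s (fun y => k * f y) x := by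
  rw [← div_le_iff₀' (by positivity)]
  refine le_QInf fun y => ?_
  have h1 := QInf_le (M := (k + h) * M) (g := fun y => (k + h) * f y) hα hs.le
    (fun y => by rw [abs_mul, abs_of_pos (by positivity)]; gcongr; exact hf y) x y
  have h2 := mul_nonneg hs.le (hα.nonneg (dist x y))
  rw [div_le_iff₀' (by positivity)]
  nlinarith [mul_le_mul_of_nonneg_left h1 hk.le, mul_nonneg hh h2]

theorem gradMinus_eq_zero_of_isolated {f : X → ℝ} {x : X} (h : 𝓝[≠] x = ⊥) :
    gradMinus f x = 0 := by
  simp [gradMinus, h, limsup, limsSup]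

/-- The Hamilton-Jacobi type inequality for `k ↦ Q^s(k f)`, in terms of difference quotients. -/
theorem mul_legendre_gradMinus_QInf_le (hα : IsYoung α) {A : ℝ} (hA : 0 < A) (hs : 0 < s)
    (hscale : ∀ u > 0, ∀ x, A * (x * (s * rightD α u) - α x) ≤ s * α u) {f : X → ℝ}
    (hf : ∀ y, |f y| ≤ M) {k h : ℝ} (hk : 0 < k) (hh : 0 < h) (x : X) :
    ENNReal.ofReal A * legendre α (gradMinus (QInf α s fun y => k * f y) x) ≤
      ENNReal.ofReal (QInf α s (fun y => k * f y) x -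
        k * (QInf α s (fun y => (k + h) * f y) x - QInf α s (fun y => k * f y) x) / h) := by
  rcases (𝓝[≠] x).eq_or_neBot with hbot | hne
  · simp [gradMinus_eq_zero_of_isolated hbot, hα.legendre_zero]
  have hbound : ∀ {c : ℝ}, 0 < c → ∀ y, |c * f y| ≤ c * M := fun {c} hc y => by
    rw [abs_mul, abs_of_pos hc]; gcongr; exact hf y
  have hsup := mul_QInf_add_le hα hs hf hk hh.le x
  have hG' := QInf_le hα hs.le (hbound (add_pos hk hh)) x
  have hgk := hbound hk
  obtain ⟨W, hW, hcost⟩ := exists_cost_sub_le hα hs hgk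
  obtain ⟨L, hL, hlip⟩ := exists_QInf_sub_le hα hs hgk
  have hmin := @exists_lt_QInf_add X _ α s fun y => k * f y
  have hle := QInf_le hα hs.le hgk
  set G := QInf α s fun y => k * f y
  set G' := QInf α s (fun y => (k + h) * f y) x
  set D := G x - k * (G' - G x) / h with hD
  have hhD : h * D = h * G x - k * (G' - G x) := by rw [hD]; field_simp
  have hD0 : 0 ≤ D := by
    have : 0 ≤ h * D := by rw [hhD]; linarith
    exact nonneg_of_mul_nonneg_right this hh
  refine ENNReal.le_of_forall_pos_le_add fun ε hε _ => ?_
  have hε : (0 : ℝ) < ε := hε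
  rw [← ENNReal.ofReal_coe_nnreal, ← ENNReal.ofReal_add hD0 hε.le]
  obtain ⟨v, hv, hvD⟩ := hα.exists_eq (c := (D + ε) / s) (by positivity)
  have hsv : s * α v = D + ε := by rw [hvD]; field_simp
  have hdist : Tendsto (fun x' => dist x x') (𝓝[≠] x) (𝓝 0) := by
    have : Tendsto (fun x' => dist x x') (𝓝 x) (𝓝 (dist x x)) :=
      (continuous_const.dist continuous_id).tendsto x
    rw [dist_self] at this
    exact this.mono_left nhdsWithin_le_nhds
  have herr : Tendsto (fun x' => (k + h) * ((L + 1 + s * W) * dist x x')) (𝓝[≠] x) (𝓝 0) := by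
    simpa using (hdist.const_mul (L + 1 + s * W)).const_mul (k + h)
  have hquot : ∀ᶠ x' in 𝓝[≠] x,
      max (-(G x' - G x)) 0 / dist x' x ≤ s * rightD α v + dist x x' := by
    filter_upwards [self_mem_nhdsWithin, hdist.eventually_le_const one_pos,
      herr.eventually_le_const (mul_pos hh hε)] with x' hx' hd1 herr'
    have hd : 0 < dist x x' := dist_pos.2 (Ne.symm hx')
    have hsq : dist x x' * dist x x' ≤ dist x x' := by nlinarith
    obtain ⟨y', hy'⟩ := hmin x' (mul_pos hd hd)
    have hc := mul_le_mul_of_nonneg_left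
      (hcost x x' y' hd1 (hy'.le.trans (by linarith))) hs.le
    have hl := hlip x' x (by rwa [dist_comm])
    rw [dist_comm x' x] at hl
    have hup : h * (s * α (dist x y')) ≤ h * (D + ε) := by
      have h1 := mul_le_mul_of_nonneg_left (hG' y') hk.le
      have h2 : k * f y' ≤ G x + (L + 1 + s * W) * dist x x' - s * α (dist x y') := by linarith
      have h3 := mul_le_mul_of_nonneg_left h2 (add_pos hk hh).le
      linarith
    have hdv : dist x y' ≤ v := by
      refine (hα.mono.le_iff_le dist_nonneg hv.le).1 ?_
      have := le_of_mul_le_mul_left hup hh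
      rw [← hsv] at this
      exact le_of_mul_le_mul_left this hs
    have hinc := mul_le_mul_of_nonneg_left (hα.sub_le_rightD_mul (b := dist x' y') (δ := dist x x')
      dist_nonneg dist_nonneg hdv (by linarith [dist_triangle x x' y']) dist_nonneg) hs.le
    rw [dist_comm x' x, div_le_iff₀ hd]
    refine max_le ?_ (mul_nonneg (add_nonneg (mul_nonneg hs.le (hα.rightD_nonneg hv.le)) hd.le) hd.le)
    linarith [hle x y']
  have hnonneg : ∀ x', 0 ≤ max (-(G x' - G x)) 0 / dist x' x := fun x' => by positivity
  have hgrad : gradMinus G x ≤ s * rightD α v := by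
    refine le_of_forall_pos_le_add fun ε' hε' => limsup_le_of_le
      (isBoundedUnder_of ⟨0, hnonneg⟩).isCoboundedUnder_le ?_
    filter_upwards [hquot, hdist.eventually_le_const hε'] with x' h1 h2
    linarith
  have hgrad0 : 0 ≤ gradMinus G x := by
    refine le_limsup_of_frequently_le (Frequently.of_forall hnonneg)
      ⟨s * rightD α v + 1, eventually_map.2 ?_⟩
    filter_upwards [hquot, hdist.eventually_le_const one_pos] with x' h1 h2
    linarith
  rw [← hsv]
  exact hα.mul_legendre_le hA (hscale v hv) hgrad0 hgrad

end QInf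

theorem exp_le_exp_mul_one_add {a b c : ℝ} (h : |b - a| ≤ c) (hc : c ≤ 1) :
    Real.exp b ≤ Real.exp a * (1 + (b - a) + c ^ 2) := by
  have h1 := (abs_le.1 (Real.abs_exp_sub_one_sub_id_le (h.trans hc))).2
  have h2 : (b - a) ^ 2 ≤ c ^ 2 := sq_le_sq' (abs_le.1 h).1 (abs_le.1 h).2
  calc Real.exp b = Real.exp a * Real.exp (b - a) := by rw [← Real.exp_add]; ring_nf
    _ ≤ _ := by gcongr; linarith

section FunctionalInequality

variable {X : Type*} [MetricSpace X] [MeasurableSpace X] [BorelSpace X] {α : ℝ → ℝ} {A s M : ℝ}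
  {μ : Measure X} [IsProbabilityMeasure μ] {f : X → ℝ}

theorem integrable_of_continuous_of_abs_le {ν : Measure X} [IsFiniteMeasure ν] {g : X → ℝ}
    (hg : Continuous g) {C : ℝ} (hC : ∀ x, |g x| ≤ C) : Integrable g ν :=
  Integrable.of_bound hg.aestronglyMeasurable C (ae_of_all _ hC)

theorem integrable_mul_exp {g u : X → ℝ} (hg : Continuous g) (hgM : ∀ x, |g x| ≤ M)
    (hu : Continuous u) {C : ℝ} (hC : ∀ x, |u x| ≤ C) :
    Integrable (fun x => u x * Real.exp (g x)) μ := by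
  refine integrable_of_continuous_of_abs_le (C := C * Real.exp M)
    (hu.mul (Real.continuous_exp.comp hg)) fun x => ?_
  rw [abs_mul, Real.abs_exp]
  exact mul_le_mul (hC x) (Real.exp_le_exp.2 ((le_abs_self _).trans (hgM x))) (Real.exp_nonneg _)
    ((abs_nonneg _).trans (hC x))

theorem integrable_exp_of_abs_le {g : X → ℝ} (hg : Continuous g) (hgM : ∀ x, |g x| ≤ M) :
    Integrable (fun x => Real.exp (g x)) μ := by
  simpa using integrable_mul_exp (u := fun _ => 1) hg hgM continuous_const (C := 1) (by simp)

/-- The modified log-Sobolev inequality applied to `Q^s(k f)`. -/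
theorem LSIminus.integral_QInf_sub_mul_exp_le (hLSI : LSIminus μ α A) (hα : IsYoung α)
    (hA : 0 < A) (hs : 0 < s)
    (hscale : ∀ u > 0, ∀ x, A * (x * (s * rightD α u) - α x) ≤ s * α u)
    (hf : ∀ y, |f y| ≤ M) {k h : ℝ} (hk : 0 < k) (hh : 0 < h) :
    k / h * ∫ x, (QInf α s (fun y => (k + h) * f y) x - QInf α s (fun y => k * f y) x) *
        Real.exp (QInf α s (fun y => k * f y) x) ∂μ ≤
      (∫ x, Real.exp (QInf α s (fun y => k * f y) x) ∂μ) *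
        Real.log (∫ x, Real.exp (QInf α s (fun y => k * f y) x) ∂μ) := by
  have hbound : ∀ {c : ℝ}, 0 < c → ∀ y, |c * f y| ≤ c * M := fun {c} hc y => by
    rw [abs_mul, abs_of_pos hc]; gcongr; exact hf y
  have hpt := mul_legendre_gradMinus_QInf_le hα hA hs hscale hf hk hh
  have hsup := mul_QInf_add_le hα hs hf hk hh.le
  have hGlip := locallyLipschitz_QInf hα hs (hbound hk)
  have hGb := abs_QInf_le hα hs.le (hbound hk)
  have hG'c := (locallyLipschitz_QInf hα hs (hbound (add_pos hk hh))).continuous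
  have hG'b := abs_QInf_le hα hs.le (hbound (add_pos hk hh))
  set G := QInf α s fun y => k * f y
  set G' := QInf α s fun y => (k + h) * f y
  have hGc := hGlip.continuous
  have hdiff : Integrable (fun x => (G' x - G x) * Real.exp (G x)) μ :=
    integrable_mul_exp hGc hGb (hG'c.sub hGc) fun x => (abs_sub _ _).trans
      (add_le_add (hG'b x) (hGb x))
  have hself : Integrable (fun x => G x * Real.exp (G x)) μ := integrable_mul_exp hGc hGb hGc hGb
  have hsplit : ∀ x, (G x - k * (G' x - G x) / h) * Real.exp (G x) =
      G x * Real.exp (G x) - k / h * ((G' x - G x) * Real.exp (G x)) := fun x => by ring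
  have hint : Integrable (fun x => (G x - k * (G' x - G x) / h) * Real.exp (G x)) μ := by
    simp_rw [hsplit]
    exact hself.sub (hdiff.const_mul _)
  have hnn : ∀ x, 0 ≤ (G x - k * (G' x - G x) / h) * Real.exp (G x) := fun x => by
    refine mul_nonneg ?_ (Real.exp_nonneg _)
    rw [sub_nonneg, div_le_iff₀ hh]
    linarith [hsup x]
  have hent : entExp μ G ≤ ∫ x, (G x - k * (G' x - G x) / h) * Real.exp (G x) ∂μ := by
    rw [← ENNReal.ofReal_le_ofReal_iff (integral_nonneg hnn),
      ofReal_integral_eq_lintegral_ofReal hint (ae_of_all _ hnn)]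
    refine (hLSI G ⟨_, hGb⟩ hGlip).trans ?_
    rw [← lintegral_const_mul' _ _ ENNReal.ofReal_ne_top]
    refine lintegral_mono fun x => ?_
    rw [← mul_assoc, ENNReal.ofReal_mul' (Real.exp_nonneg _)]
    gcongr
    exact hpt x
  simp_rw [hsplit] at hent
  rw [integral_sub hself (hdiff.const_mul _), integral_const_mul] at hent
  simp only [entExp, Real.log_exp] at hent
  simp_rw [mul_comm (Real.exp (G _)) (G _)] at hent
  linarith

theorem LSIminus.log_integral_exp_QInf_add_le (hLSI : LSIminus μ α A) (hα : IsYoung α)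
    (hA : 0 < A) (hs : 0 < s)
    (hscale : ∀ u > 0, ∀ x, A * (x * (s * rightD α u) - α x) ≤ s * α u)
    (hf : ∀ y, |f y| ≤ M) {k h : ℝ} (hk : 0 < k) (hh : 0 < h) (hhM : h * M ≤ 1) :
    Real.log (∫ x, Real.exp (QInf α s (fun y => (k + h) * f y) x) ∂μ) ≤
      (k + h) / k * Real.log (∫ x, Real.exp (QInf α s (fun y => k * f y) x) ∂μ) +
        (h * M) ^ 2 := by
  have hbound : ∀ {c : ℝ}, 0 < c → ∀ y, |c * f y| ≤ c * M := fun {c} hc y => by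
    rw [abs_mul, abs_of_pos hc]; gcongr; exact hf y
  have hstep := hLSI.integral_QInf_sub_mul_exp_le hα hA hs hscale hf hk hh
  have hclose : ∀ x, |QInf α s (fun y => (k + h) * f y) x - QInf α s (fun y => k * f y) x| ≤
      h * M := fun x => by
    have h1 := QInf_le_QInf_add hα hs.le (hbound (add_pos hk hh)) (g' := fun y => k * f y)
      (c := h * M) (fun y => by linarith [(abs_le.1 (hbound hh y)).2]) x
    have h2 := QInf_le_QInf_add hα hs.le (hbound hk) (g' := fun y => (k + h) * f y)
      (c := h * M) (fun y => by linarith [(abs_le.1 (hbound hh y)).1]) x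
    exact abs_le.2 ⟨by linarith, by linarith⟩
  have hGc := (locallyLipschitz_QInf hα hs (hbound hk)).continuous
  have hGb := abs_QInf_le hα hs.le (hbound hk)
  have hG'c := (locallyLipschitz_QInf hα hs (hbound (add_pos hk hh))).continuous
  have hG'b := abs_QInf_le hα hs.le (hbound (add_pos hk hh))
  set G := QInf α s fun y => k * f y
  set G' := QInf α s fun y => (k + h) * f y
  have hexp : Integrable (fun x => Real.exp (G x)) μ := integrable_exp_of_abs_le hGc hGb
  have hexp' : Integrable (fun x => Real.exp (G' x)) μ := integrable_exp_of_abs_le hG'c hG'b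
  have hdiff : Integrable (fun x => (G' x - G x) * Real.exp (G x)) μ :=
    integrable_mul_exp hGc hGb (hG'c.sub hGc) hclose
  have hle : ∫ x, Real.exp (G' x) ∂μ ≤ ∫ x, (1 + (h * M) ^ 2) * Real.exp (G x) +
      (G' x - G x) * Real.exp (G x) ∂μ := by
    refine integral_mono hexp' ((hexp.const_mul _).add hdiff) fun x => ?_
    exact (exp_le_exp_mul_one_add (hclose x) hhM).trans_eq (by ring)
  rw [integral_add (hexp.const_mul _) hdiff, integral_const_mul] at hle
  have hZ : 0 < ∫ x, Real.exp (G x) ∂μ := integral_exp_pos hexp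
  have hZ' : 0 < ∫ x, Real.exp (G' x) ∂μ := integral_exp_pos hexp'
  set Z := ∫ x, Real.exp (G x) ∂μ
  set Z' := ∫ x, Real.exp (G' x) ∂μ
  have hlog : Real.log Z' - Real.log Z ≤ Z' / Z - 1 := by
    rw [← Real.log_div hZ'.ne' hZ.ne']
    exact Real.log_le_sub_one_of_pos (div_pos hZ' hZ)
  have hquot : Z' / Z ≤ 1 + (h * M) ^ 2 + h / k * Real.log Z := by
    rw [div_le_iff₀ hZ]
    have := mul_le_mul_of_nonneg_left hstep (div_pos hh hk).le
    rw [← mul_assoc, div_mul_div_cancel₀ hk.ne', div_self hh.ne', one_mul] at this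
    linarith
  have : (k + h) / k * Real.log Z = Real.log Z + h / k * Real.log Z := by field_simp
  linarith

theorem LSIminus.log_integral_exp_QInf_nsmul_le (hLSI : LSIminus μ α A) (hα : IsYoung α)
    (hA : 0 < A) (hs : 0 < s)
    (hscale : ∀ u > 0, ∀ x, A * (x * (s * rightD α u) - α x) ≤ s * α u)
    (hfc : Continuous f) (hf : ∀ y, |f y| ≤ M) {h : ℝ} (hh : 0 < h) (hhM : h * M ≤ 1) (j : ℕ) :
    Real.log (∫ x, Real.exp (QInf α s (fun y => ((j + 1 : ℕ) * h) * f y) x) ∂μ) ≤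
      (j + 1 : ℕ) * h * (∫ x, f x ∂μ +
        h * M ^ 2 * ∑ i ∈ Finset.range (j + 1), 1 / ((i : ℝ) + 1)) := by
  induction j with
  | zero =>
    have hb : ∀ y, |h * f y| ≤ h * M := fun y => by
      rw [abs_mul, abs_of_pos hh]; gcongr; exact hf y
    have hexp : Integrable (fun x => Real.exp (QInf α s (fun y => h * f y) x)) μ :=
      integrable_exp_of_abs_le (locallyLipschitz_QInf hα hs hb).continuous
        (abs_QInf_le hα hs.le hb)
    have hint : Integrable f μ := integrable_of_continuous_of_abs_le hfc hf
    have h1 := Real.log_le_sub_one_of_pos (integral_exp_pos hexp)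
    have h2 : ∫ x, Real.exp (QInf α s (fun y => h * f y) x) ∂μ ≤
        ∫ x, (1 + (h * M) ^ 2) + h * f x ∂μ := by
      refine integral_mono hexp ((integrable_const _).add (hint.const_mul _)) fun x => ?_
      refine (Real.exp_le_exp.2 (QInf_le_self hα hs.le hb x)).trans ?_
      have := exp_le_exp_mul_one_add (a := 0) (b := h * f x) (by simpa using hb x) hhM
      simp only [Real.exp_zero] at this
      linarith
    rw [integral_add (integrable_const _) (hint.const_mul _), integral_const_mul] at h2
    simp only [integral_const, probReal_univ, smul_eq_mul, one_mul] at h2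
    simp
    linarith
  | succ j ih =>
    have hk : 0 < ((j + 1 : ℕ) : ℝ) * h := by positivity
    have hstep := hLSI.log_integral_exp_QInf_add_le hα hA hs hscale hf hk hh hhM
    have hcast : ((j + 1 : ℕ) : ℝ) * h + h = ((j + 1 + 1 : ℕ) : ℝ) * h := by push_cast; ring
    rw [hcast] at hstep
    refine hstep.trans ?_
    have := mul_le_mul_of_nonneg_left ih
      (show 0 ≤ ((j + 1 + 1 : ℕ) : ℝ) * h / (((j + 1 : ℕ) : ℝ) * h) by positivity)
    refine (add_le_add_left this _).trans_eq ?_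
    rw [Finset.sum_range_succ _ (j + 1)]
    push_cast
    field_simp
    ring

/-- The exponential inequality dual to the transport-entropy inequality. -/
theorem LSIminus.log_integral_exp_QInf_le (hLSI : LSIminus μ α A) (hα : IsYoung α)
    (hA : 0 < A) (hs : 0 < s)
    (hscale : ∀ u > 0, ∀ x, A * (x * (s * rightD α u) - α x) ≤ s * α u)
    (hfc : Continuous f) (hf : ∀ y, |f y| ≤ M) :
    Real.log (∫ x, Real.exp (QInf α s f x) ∂μ) ≤ ∫ x, f x ∂μ := by
  have hlim : Tendsto (fun n : ℕ => ∫ x, f x ∂μ + M ^ 2 *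
      ((n : ℝ)⁻¹ * ∑ i ∈ Finset.range n, 1 / ((i : ℝ) + 1))) atTop (𝓝 (∫ x, f x ∂μ)) := by
    simpa using (tendsto_one_div_add_atTop_nhds_zero_nat (𝕜 := ℝ)).cesaro.const_mul (M ^ 2)
      |>.const_add (∫ x, f x ∂μ)
  refine ge_of_tendsto hlim ?_
  filter_upwards [eventually_gt_atTop 0, eventually_ge_atTop ⌈M⌉₊] with n hn hnM
  have hn' : (0 : ℝ) < n := by exact_mod_cast hn
  obtain ⟨j, rfl⟩ : ∃ j, n = j + 1 := ⟨n - 1, by omega⟩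
  have hM : ((j + 1 : ℕ) : ℝ)⁻¹ * M ≤ 1 := by
    rw [inv_mul_le_iff₀ hn', mul_one]
    exact (Nat.le_ceil M).trans (by exact_mod_cast hnM)
  have := hLSI.log_integral_exp_QInf_nsmul_le hα hA hs hscale hfc hf (inv_pos.2 hn') hM j
  rw [mul_inv_cancel₀ hn'.ne'] at this
  simp only [one_mul] at this
  refine this.trans_eq ?_
  ring

end FunctionalInequality

section KantorovichDuality

open scoped BoundedContinuousFunction CompactlySupported

variable {X : Type*} [MetricSpace X] [MeasurableSpace X] [BorelSpace X]
  {ν μ : Measure X} [IsProbabilityMeasure ν] {c : X × X → ℝ} {L : ℝ}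

/-- The values `∫ φ dν + ∫ ψ dμ + t L` over all dominations `u ≤ φ ⊕ ψ + t c` with `t ≥ 0`. -/
def dominationValues (ν μ : Measure X) (c : X × X → ℝ) (L : ℝ) (u : X × X → ℝ) : Set ℝ :=
  {r | ∃ φ ψ : X →ᵇ ℝ, ∃ t : ℝ, 0 ≤ t ∧ (∀ z, u z ≤ φ z.1 + ψ z.2 + t * c z) ∧
    r = ∫ x, φ x ∂ν + ∫ y, ψ y ∂μ + t * L}

theorem le_of_mem_dominationValues_of_pos
    (hdual : ∀ φ ψ : X →ᵇ ℝ, (∀ x y, φ x + ψ y ≤ c (x, y)) → ∫ x, φ x ∂ν + ∫ y, ψ y ∂μ ≤ L)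
    {u : X × X → ℝ} {B : ℝ} (hB : ∀ z, -B ≤ u z) {φ ψ : X →ᵇ ℝ} {t : ℝ} (ht : 0 < t)
    (h : ∀ z, u z ≤ φ z.1 + ψ z.2 + t * c z) :
    -B ≤ ∫ x, φ x ∂ν + ∫ y, ψ y ∂μ + t * L := by
  have key := hdual (-t⁻¹ • (φ + BoundedContinuousFunction.const X B)) (-t⁻¹ • ψ) fun x y => by
    have h1 := (hB (x, y)).trans (h (x, y))
    simp only [BoundedContinuousFunction.coe_smul, BoundedContinuousFunction.coe_add,
      BoundedContinuousFunction.const_apply, Pi.add_apply, smul_eq_mul]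
    have h2 : t⁻¹ * (-(φ x) - B - ψ y) ≤ c (x, y) := by
      rw [inv_mul_le_iff₀ ht]; dsimp only at h1; linarith
    linarith
  simp only [BoundedContinuousFunction.coe_smul, BoundedContinuousFunction.coe_add,
    BoundedContinuousFunction.const_apply, Pi.add_apply, smul_eq_mul, integral_const_mul] at key
  rw [integral_add (φ.integrable ν) (integrable_const _), integral_const, probReal_univ,
    one_smul] at key
  have h3 : t⁻¹ * (-(∫ x, φ x ∂ν) - B - ∫ y, ψ y ∂μ) ≤ L := by linarith
  rw [inv_mul_le_iff₀ ht] at h3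
  linarith

theorem le_of_mem_dominationValues (hc0 : ∀ z, 0 ≤ c z)
    (hdual : ∀ φ ψ : X →ᵇ ℝ, (∀ x y, φ x + ψ y ≤ c (x, y)) → ∫ x, φ x ∂ν + ∫ y, ψ y ∂μ ≤ L)
    {u : X × X → ℝ} {B : ℝ} (hB : ∀ z, -B ≤ u z) {r : ℝ}
    (hr : r ∈ dominationValues ν μ c L u) : -B ≤ r := by
  obtain ⟨φ, ψ, t, ht, h, rfl⟩ := hr
  have hL : 0 ≤ L := by simpa using hdual 0 0 fun x y => by simpa using hc0 (x, y)
  refine le_of_forall_pos_le_add fun ε hε => ?_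
  have hδ : 0 < ε / (L + 1) := by positivity
  have key := le_of_mem_dominationValues_of_pos hdual hB (add_pos_of_nonneg_of_pos ht hδ)
    (φ := φ) (ψ := ψ) fun z => (h z).trans (by
      have := mul_nonneg hδ.le (hc0 z); nlinarith)
  have : ε / (L + 1) * L ≤ ε := by
    rw [div_mul_eq_mul_div, div_le_iff₀ (by positivity)]; nlinarith
  linarith

variable [IsProbabilityMeasure μ]

/-- Hahn-Banach step of the Kantorovich duality. -/
theorem exists_linearMap_le_domination (hc0 : ∀ z, 0 ≤ c z)
    (hdual : ∀ φ ψ : X →ᵇ ℝ, (∀ x y, φ x + ψ y ≤ c (x, y)) → ∫ x, φ x ∂ν + ∫ y, ψ y ∂μ ≤ L) :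
    ∃ Λ : ((X × X) →ᵇ ℝ) →ₗ[ℝ] ℝ, ∀ (u : (X × X) →ᵇ ℝ) (φ ψ : X →ᵇ ℝ) (t : ℝ), 0 ≤ t →
      (∀ z, u z ≤ φ z.1 + ψ z.2 + t * c z) → Λ u ≤ ∫ x, φ x ∂ν + ∫ y, ψ y ∂μ + t * L := by
  set S : ((X × X) →ᵇ ℝ) → Set ℝ := fun u => dominationValues ν μ c L u with hS
  have hbdd : ∀ u, BddBelow (S u) := fun u => ⟨-‖u‖, fun r hr =>
    le_of_mem_dominationValues hc0 hdual (fun z => (abs_le.1 (u.norm_coe_le_norm z)).1) hr⟩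
  have hne : ∀ u, (S u).Nonempty := fun u => ⟨_, BoundedContinuousFunction.const X ‖u‖, 0, 0,
    le_rfl, fun z => by simpa using (abs_le.1 (u.norm_coe_le_norm z)).2, rfl⟩
  have hsmul : ∀ k : ℝ, 0 < k → ∀ u, ∀ r ∈ S u, k * r ∈ S (k • u) := by
    rintro k hk u _ ⟨φ, ψ, t, ht, h, rfl⟩
    refine ⟨k • φ, k • ψ, k * t, by positivity, fun z => ?_, ?_⟩
    · have := mul_le_mul_of_nonneg_left (h z) hk.le
      simp only [BoundedContinuousFunction.coe_smul, smul_eq_mul]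
      linarith
    · simp only [BoundedContinuousFunction.coe_smul, smul_eq_mul, integral_const_mul]
      ring
  have hle : ∀ k : ℝ, 0 < k → ∀ u, sInf (S (k • u)) ≤ k * sInf (S u) := by
    intro k hk u
    rw [← div_le_iff₀' hk]
    refine le_csInf (hne u) fun r hr => ?_
    rw [div_le_iff₀' hk]
    exact csInf_le (hbdd _) (hsmul k hk u r hr)
  obtain ⟨Λ, -, hΛ⟩ := exists_extension_of_le_sublinear (⊥ : ((X × X) →ᵇ ℝ) →ₗ.[ℝ] ℝ)
    (fun u => sInf (S u)) (fun k hk u => le_antisymm (hle k hk u) (by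
      have := hle k⁻¹ (inv_pos.2 hk) (k • u)
      rw [inv_smul_smul₀ hk.ne', le_inv_mul_iff₀ hk] at this
      exact this))
    (fun u v => by
      rw [← sub_le_iff_le_add]
      refine le_csInf (hne u) fun r hr => ?_
      rw [sub_le_comm]
      refine le_csInf (hne v) fun q hq => ?_
      rw [sub_le_iff_le_add']
      refine csInf_le (hbdd _) ?_
      obtain ⟨φ, ψ, t, ht, h, rfl⟩ := hr
      obtain ⟨φ', ψ', t', ht', h', rfl⟩ := hq
      refine ⟨φ + φ', ψ + ψ', t + t', by positivity, fun z => ?_, ?_⟩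
      · have := add_le_add (h z) (h' z)
        simp only [BoundedContinuousFunction.coe_add, Pi.add_apply]
        linarith
      · simp only [BoundedContinuousFunction.coe_add, Pi.add_apply]
        rw [integral_add (φ.integrable ν) (φ'.integrable ν),
          integral_add (ψ.integrable μ) (ψ'.integrable μ)]
        ring)
    (fun x => by
      have hx : (x : (X × X) →ᵇ ℝ) = 0 := (Submodule.mem_bot ℝ).1 x.2
      have hx' : x = 0 := Subtype.ext hx
      subst hx'
      simp only [LinearPMap.map_zero]
      refine le_csInf (hne _) fun r hr => ?_
      simpa using le_of_mem_dominationValues (B := 0) hc0 hdual (fun z => by simp) hr)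
  exact ⟨Λ, fun u φ ψ t ht h => (hΛ u).trans (csInf_le (hbdd u) ⟨φ, ψ, t, ht, h, rfl⟩)⟩

/-- A positive functional on bounded continuous functions that does not charge infinity is the
integral with respect to a finite measure. -/
theorem exists_isFiniteMeasure_integral_eq {Y : Type*} [MetricSpace Y] [ProperSpace Y]
    [MeasurableSpace Y] [BorelSpace Y] (Λ : (Y →ᵇ ℝ) →ₗ[ℝ] ℝ)
    (hpos : ∀ u : Y →ᵇ ℝ, (∀ y, 0 ≤ u y) → 0 ≤ Λ u) (χ : ℕ → C_c(Y, ℝ))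
    (hχ0 : ∀ n y, 0 ≤ χ n y) (hχ1 : ∀ n y, χ n y ≤ 1)
    (hχ : ∀ y, Tendsto (fun n => χ n y) atTop (𝓝 1))
    (hΛ : Tendsto (fun n => Λ (1 - (χ n).toBoundedContinuousFunction)) atTop (𝓝 0)) :
    ∃ π : Measure Y, IsFiniteMeasure π ∧ ∀ u : Y →ᵇ ℝ, ∫ y, u y ∂π = Λ u := by
  have hmono : ∀ u v : Y →ᵇ ℝ, (∀ y, u y ≤ v y) → Λ u ≤ Λ v := fun u v h => by
    have := hpos (v - u) fun y => by simpa using h y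
    rw [map_sub] at this; linarith
  let Λc : C_c(Y, ℝ) →ₗ[ℝ] ℝ :=
    { toFun := fun f => Λ f.toBoundedContinuousFunction
      map_add' := fun f g => by rw [← map_add]; rfl
      map_smul' := fun k f => by rw [RingHom.id_apply, ← map_smul]; rfl }
  let Λp : C_c(Y, ℝ) →ₚ[ℝ] ℝ := PositiveLinearMap.mk₀ Λc fun f hf => hpos _ fun y => hf y
  set π := RealRMK.rieszMeasure Λp with hπ
  have hint : ∀ f : C_c(Y, ℝ), ∫ y, f y ∂π = Λ f.toBoundedContinuousFunction := fun f =>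
    RealRMK.integral_rieszMeasure Λp f
  have hfin : IsFiniteMeasure π := by
    refine ⟨lt_of_le_of_lt (b := ENNReal.ofReal (Λ 1)) ?_ ENNReal.ofReal_lt_top⟩
    calc π univ = ∫⁻ y, liminf (fun n => ENNReal.ofReal (χ n y)) atTop ∂π := by
          rw [← lintegral_one]
          refine lintegral_congr fun y => ?_
          have := (ENNReal.continuous_ofReal.tendsto 1).comp (hχ y)
          simpa using! this.liminf_eq.symm
      _ ≤ liminf (fun n => ∫⁻ y, ENNReal.ofReal (χ n y) ∂π) atTop :=
          lintegral_liminf_le fun n =>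
            ((χ n).continuous.measurable).ennreal_ofReal
      _ ≤ ENNReal.ofReal (Λ 1) := by
          refine liminf_le_of_le (by isBoundedDefault) fun b hb => ?_
          obtain ⟨n, hn⟩ := hb.exists
          refine hn.trans ?_
          have hi : Integrable (fun y => χ n y) π :=
            (χ n).continuous.integrable_of_hasCompactSupport (χ n).hasCompactSupport
          rw [← ofReal_integral_eq_lintegral_ofReal hi (ae_of_all _ (hχ0 n)), hint]
          exact ENNReal.ofReal_le_ofReal (hmono _ _ fun y => hχ1 n y)
  refine ⟨π, hfin, fun u => ?_⟩
  have h1 : Tendsto (fun n => ∫ y, u y * χ n y ∂π) atTop (𝓝 (∫ y, u y ∂π)) := by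
    refine tendsto_integral_of_dominated_convergence (fun _ => ‖u‖)
      (fun n => (u.continuous.mul (χ n).continuous).aestronglyMeasurable) (integrable_const _)
      (fun n => ae_of_all _ fun y => ?_) (ae_of_all _ fun y => ?_)
    · rw [norm_mul, Real.norm_of_nonneg (hχ0 n y)]
      exact (mul_le_of_le_one_right (norm_nonneg _) (hχ1 n y)).trans (u.norm_coe_le_norm y)
    · simpa using (hχ y).const_mul (u y)
  have hprod : ∀ n, ∫ y, u y * χ n y ∂π = Λ (u * (χ n).toBoundedContinuousFunction) := fun n =>
    hint ⟨⟨fun y => u y * χ n y, u.continuous.mul (χ n).continuous⟩,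
      (χ n).hasCompactSupport.mul_left⟩
  have h2 : Tendsto (fun n => ∫ y, u y * χ n y ∂π) atTop (𝓝 (Λ u)) := by
    have hz : Tendsto (fun n => ‖u‖ * Λ (1 - (χ n).toBoundedContinuousFunction)) atTop (𝓝 0) := by
      simpa using hΛ.const_mul ‖u‖
    rw [tendsto_iff_norm_sub_tendsto_zero]
    refine squeeze_zero (fun _ => norm_nonneg _) (fun n => ?_) hz
    rw [hprod, ← map_sub, ← smul_eq_mul ‖u‖, ← map_smul, Real.norm_eq_abs, abs_le, ← map_neg]
    have hpt : ∀ y, |u y * χ n y - u y| ≤ ‖u‖ * (1 - χ n y) := fun y => by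
      have : u y * χ n y - u y = -(u y * (1 - χ n y)) := by ring
      rw [this, abs_neg, abs_mul, abs_of_nonneg (sub_nonneg.2 (hχ1 n y))]
      exact mul_le_mul_of_nonneg_right (u.norm_coe_le_norm y) (sub_nonneg.2 (hχ1 n y))
    exact ⟨hmono _ _ fun y => (abs_le.1 (hpt y)).1, hmono _ _ fun y => (abs_le.1 (hpt y)).2⟩
  exact tendsto_nhds_unique h1 h2

/-- The cutoff equal to `1` on the ball of radius `n` around `o` and to `0` outside the ball of
radius `n + 1`. -/
def ballCutoff {Y : Type*} [MetricSpace Y] [ProperSpace Y] (o : Y) (n : ℕ) : C_c(Y, ℝ) where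
  toFun y := max 0 (min 1 (n + 1 - dist y o))
  continuous_toFun := by fun_prop
  hasCompactSupport' := by
    refine HasCompactSupport.intro (isCompact_closedBall o (n + 1)) fun y hy => ?_
    rw [Metric.mem_closedBall, not_le] at hy
    exact max_eq_left ((min_le_right _ _).trans (by linarith))

section ballCutoff

variable {Y : Type*} [MetricSpace Y] [ProperSpace Y] (o : Y) (n : ℕ)

theorem ballCutoff_apply (y : Y) : ballCutoff o n y = max 0 (min 1 (n + 1 - dist y o)) := rfl

theorem ballCutoff_nonneg (y : Y) : 0 ≤ ballCutoff o n y := le_max_left _ _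

theorem ballCutoff_le_one (y : Y) : ballCutoff o n y ≤ 1 := max_le zero_le_one (min_le_left _ _)

theorem tendsto_ballCutoff (y : Y) : Tendsto (fun n => ballCutoff o n y) atTop (𝓝 1) := by
  refine tendsto_const_nhds.congr' ?_
  filter_upwards [eventually_ge_atTop ⌈dist y o⌉₊] with n hn
  have : dist y o ≤ n := (Nat.le_ceil _).trans (by exact_mod_cast hn)
  rw [ballCutoff_apply, min_eq_left (by linarith), max_eq_right zero_le_one]

theorem one_sub_ballCutoff_prod_le (z : Y × Y) : 1 - ballCutoff (o, o) n z ≤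
    (1 - ballCutoff o n z.1) + (1 - ballCutoff o n z.2) := by
  have h1 := ballCutoff_le_one o n z.1
  have h2 := ballCutoff_le_one o n z.2
  rcases le_total (dist z.1 o) (dist z.2 o) with h | h
  · have : ballCutoff (o, o) n z = ballCutoff o n z.2 := by
      simp only [ballCutoff_apply, Prod.dist_eq, max_eq_right h]
    linarith
  · have : ballCutoff (o, o) n z = ballCutoff o n z.1 := by
      simp only [ballCutoff_apply, Prod.dist_eq, max_eq_left h]
    linarith

theorem tendsto_integral_one_sub_ballCutoff [MeasurableSpace Y] [BorelSpace Y] (ν : Measure Y)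
    [IsFiniteMeasure ν] :
    Tendsto (fun n => ∫ y, (1 - ballCutoff o n y) ∂ν) atTop (𝓝 0) := by
  have := tendsto_integral_of_dominated_convergence (μ := ν) (f := fun _ => (0 : ℝ))
    (F := fun n y => 1 - ballCutoff o n y) (fun _ => (1 : ℝ))
    (fun n => (continuous_const.sub (ballCutoff o n).continuous).aestronglyMeasurable)
    (integrable_const _)
    (fun n => ae_of_all _ fun y => by
      rw [Real.norm_of_nonneg (sub_nonneg.2 (ballCutoff_le_one o n y))]
      linarith [ballCutoff_nonneg o n y])
    (ae_of_all _ fun y => by simpa using (tendsto_ballCutoff o y).const_sub 1)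
  simpa using this

end ballCutoff

/-- **Kantorovich duality** for continuous costs on proper metric spaces. -/
theorem exists_coupling_lintegral_le [ProperSpace X] (hc : Continuous c) (hc0 : ∀ z, 0 ≤ c z)
    (hdual : ∀ φ ψ : X →ᵇ ℝ, (∀ x y, φ x + ψ y ≤ c (x, y)) → ∫ x, φ x ∂ν + ∫ y, ψ y ∂μ ≤ L) :
    ∃ π : Measure (X × X), π.map Prod.fst = ν ∧ π.map Prod.snd = μ ∧
      ∫⁻ z, ENNReal.ofReal (c z) ∂π ≤ ENNReal.ofReal L := by
  obtain ⟨o⟩ : Nonempty X := nonempty_of_isProbabilityMeasure ν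
  obtain ⟨Λ, hΛ⟩ := exists_linearMap_le_domination hc0 hdual
  have hpos : ∀ u : (X × X) →ᵇ ℝ, (∀ z, 0 ≤ u z) → 0 ≤ Λ u := fun u hu => by
    have := hΛ (-u) 0 0 0 le_rfl fun z => by simpa using hu z
    simpa using this
  have htight : Tendsto (fun n => Λ (1 - (ballCutoff (o, o) n).toBoundedContinuousFunction))
      atTop (𝓝 0) := by
    have hsum := (tendsto_integral_one_sub_ballCutoff o ν).add
      (tendsto_integral_one_sub_ballCutoff o μ)
    rw [add_zero] at hsum
    refine squeeze_zero (fun n => hpos _ fun z => sub_nonneg.2 (ballCutoff_le_one _ n z))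
      (fun n => ?_) hsum
    have := hΛ (1 - (ballCutoff (o, o) n).toBoundedContinuousFunction)
      (1 - (ballCutoff o n).toBoundedContinuousFunction)
      (1 - (ballCutoff o n).toBoundedContinuousFunction) 0 le_rfl fun z => by
        simpa using! one_sub_ballCutoff_prod_le o n z
    simpa using! this
  obtain ⟨π, hπ, hint⟩ := exists_isFiniteMeasure_integral_eq Λ hpos (ballCutoff (o, o))
    (ballCutoff_nonneg _) (ballCutoff_le_one _) (tendsto_ballCutoff _) htight
  have hfst : ∀ φ : X →ᵇ ℝ, Λ (φ.compContinuous ⟨Prod.fst, continuous_fst⟩) = ∫ x, φ x ∂ν := by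
    have hle : ∀ φ : X →ᵇ ℝ, Λ (φ.compContinuous ⟨Prod.fst, continuous_fst⟩) ≤ ∫ x, φ x ∂ν :=
      fun φ => by simpa using hΛ _ φ 0 0 le_rfl fun z => by simp
    refine fun φ => le_antisymm (hle φ) ?_
    have h1 := hle (-φ)
    have h2 : (-φ).compContinuous ⟨Prod.fst, continuous_fst⟩ =
      -(φ.compContinuous (⟨Prod.fst, continuous_fst⟩ : C(X × X, X))) := rfl
    rw [h2, map_neg] at h1
    simp only [BoundedContinuousFunction.coe_neg, Pi.neg_apply, integral_neg] at h1
    linarith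
  have hsnd : ∀ ψ : X →ᵇ ℝ, Λ (ψ.compContinuous ⟨Prod.snd, continuous_snd⟩) = ∫ y, ψ y ∂μ := by
    have hle : ∀ ψ : X →ᵇ ℝ, Λ (ψ.compContinuous ⟨Prod.snd, continuous_snd⟩) ≤ ∫ y, ψ y ∂μ :=
      fun ψ => by simpa using hΛ _ 0 ψ 0 le_rfl fun z => by simp
    refine fun ψ => le_antisymm (hle ψ) ?_
    have h1 := hle (-ψ)
    have h2 : (-ψ).compContinuous ⟨Prod.snd, continuous_snd⟩ =
      -(ψ.compContinuous (⟨Prod.snd, continuous_snd⟩ : C(X × X, X))) := rfl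
    rw [h2, map_neg] at h1
    simp only [BoundedContinuousFunction.coe_neg, Pi.neg_apply, integral_neg] at h1
    linarith
  refine ⟨π, ?_, ?_, ?_⟩
  · refine ext_of_forall_integral_eq_of_IsFiniteMeasure fun φ => ?_
    rw [integral_map measurable_fst.aemeasurable φ.continuous.aestronglyMeasurable, ← hfst, ← hint]
    rfl
  · refine ext_of_forall_integral_eq_of_IsFiniteMeasure fun ψ => ?_
    rw [integral_map measurable_snd.aemeasurable ψ.continuous.aestronglyMeasurable, ← hsnd, ← hint]
    rfl
  · have htrunc : ∀ n : ℕ, ∫⁻ z, ENNReal.ofReal (min (c z) n) ∂π ≤ ENNReal.ofReal L := fun n => by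
      have hn0 : ∀ z, 0 ≤ min (c z) (n : ℝ) := fun z => le_min (hc0 z) n.cast_nonneg
      let u : (X × X) →ᵇ ℝ := BoundedContinuousFunction.ofNormedAddCommGroup
        (fun z => min (c z) n) (hc.min continuous_const) n fun z => by
          rw [Real.norm_of_nonneg (hn0 z)]; exact min_le_right _ _
      have hu : ∫ z, min (c z) (n : ℝ) ∂π ≤ L := by
        refine (hint u).trans_le ?_
        simpa using hΛ u 0 0 1 zero_le_one fun z => by
          simp only [BoundedContinuousFunction.coe_zero, Pi.zero_apply, zero_add, one_mul]
          exact min_le_left (c z) (n : ℝ)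
      have hi : Integrable (fun z => min (c z) (n : ℝ)) π := u.integrable π
      rw [← ofReal_integral_eq_lintegral_ofReal hi (ae_of_all _ hn0)]
      exact ENNReal.ofReal_le_ofReal hu
    calc ∫⁻ z, ENNReal.ofReal (c z) ∂π
        = ∫⁻ z, liminf (fun n : ℕ => ENNReal.ofReal (min (c z) n)) atTop ∂π := by
          refine lintegral_congr fun z => (Tendsto.liminf_eq ?_).symm
          refine tendsto_const_nhds.congr' ?_
          filter_upwards [eventually_ge_atTop ⌈c z⌉₊] with n hn
          rw [min_eq_left ((Nat.le_ceil _).trans (by exact_mod_cast hn))]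
      _ ≤ liminf (fun n : ℕ => ∫⁻ z, ENNReal.ofReal (min (c z) n) ∂π) atTop :=
          lintegral_liminf_le fun n => (hc.min continuous_const).measurable.ennreal_ofReal
      _ ≤ ENNReal.ofReal L := by
          refine liminf_le_of_le (by isBoundedDefault) fun b hb => ?_
          obtain ⟨n, hn⟩ := hb.exists
          exact hn.trans (htrunc n)

end KantorovichDuality

/-- The Gibbs variational inequality for the relative entropy. -/
theorem integral_le_integral_llr_add_log_integral_exp {X : Type*} [MeasurableSpace X]
    {ν μ : Measure X} [IsProbabilityMeasure ν] [IsProbabilityMeasure μ] (hνμ : ν ≪ μ)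
    (hint : Integrable (llr ν μ) ν) {g : X → ℝ} (hgν : Integrable g ν)
    (hgμ : Integrable (fun x => Real.exp (g x)) μ) :
    ∫ x, g x ∂ν ≤ ∫ x, llr ν μ x ∂ν + Real.log (∫ x, Real.exp (g x) ∂μ) := by
  have := isProbabilityMeasure_tilted hgμ
  have h := InformationTheory.integral_llr_add_sub_measure_univ_nonneg
    (hνμ.trans (absolutelyContinuous_tilted hgμ)) (integrable_llr_tilted_right hνμ hgν hint hgμ)
  rw [integral_llr_tilted_right hνμ hgν hgμ hint, probReal_univ, probReal_univ] at h
  linarith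

theorem lsi_minus_implies_transport_entropy
    {X : Type*} [MetricSpace X] [CompleteSpace X] [TopologicalSpace.SeparableSpace X]
    [ProperSpace X] [MeasurableSpace X] [BorelSpace X]
    (α : ℝ → ℝ) (hα : IsYoung α) (hΔ : DeltaTwo α)
    (μ : Measure X) [IsProbabilityMeasure μ] (A : ℝ) (hA : 0 < A)
    (hLSI : LSIminus μ α A) :
    TransportEntropy μ α
      ((1 + (pAlpha α - 1) * A) ^ (pAlpha α - rAlpha α) *
        ((pAlpha α - 1) * A) ^ (rAlpha α - 1)) := by
  obtain ⟨s, hs, hscale, hsC⟩ := hα.exists_scale hΔ hA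
  set C := (1 + (pAlpha α - 1) * A) ^ (pAlpha α - rAlpha α) * ((pAlpha α - 1) * A) ^ (rAlpha α - 1)
  have hC : 0 < C := (inv_pos.2 hs).trans_le hsC
  intro ν hν
  rw [relEnt]
  split_ifs with h
  swap
  · rw [ENNReal.mul_top (by simpa using hC)]
    exact le_top
  obtain ⟨hνμ, hint⟩ := h
  change Integrable (llr ν μ) ν at hint
  have hH : 0 ≤ ∫ x, llr ν μ x ∂ν := by
    simpa using integral_le_integral_llr_add_log_integral_exp hνμ hint (g := fun _ => 0)
      (integrable_const _) (integrable_const _)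
  obtain ⟨π, hπν, hπμ, hπ⟩ := exists_coupling_lintegral_le (ν := ν) (μ := μ)
    (c := fun z => α (dist z.1 z.2)) (L := C * ∫ x, llr ν μ x ∂ν)
    (hα.continuous.comp continuous_dist) (fun z => hα.nonneg _) fun φ ψ hφψ => by
      have hf : ∀ y, |(-s) * ψ y| ≤ s * ‖ψ‖ := fun y => by
        rw [abs_mul, abs_neg, abs_of_pos hs]
        exact mul_le_mul_of_nonneg_left (ψ.norm_coe_le_norm y) hs.le
      have hfc : Continuous fun y => (-s) * ψ y := continuous_const.mul ψ.continuous
      have hQc := (locallyLipschitz_QInf hα hs hf).continuous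
      have hQb := abs_QInf_le hα hs.le hf
      have hQi := integrable_of_continuous_of_abs_le (ν := ν) hQc hQb
      have hle : ∫ x, s * φ x ∂ν ≤ ∫ x, QInf α s (fun y => (-s) * ψ y) x ∂ν :=
        integral_mono ((φ.integrable ν).const_mul s) hQi fun x => le_QInf fun y => by
          have := mul_le_mul_of_nonneg_left (hφψ x y) hs.le
          dsimp only at this ⊢
          linarith
      have hgibbs := integral_le_integral_llr_add_log_integral_exp hνμ hint hQi
        (integrable_exp_of_abs_le hQc hQb)
      have hlog := hLSI.log_integral_exp_QInf_le hα hA hs hscale hfc hf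
      rw [integral_const_mul] at hle hlog
      have key : ∫ x, φ x ∂ν + ∫ y, ψ y ∂μ ≤ s⁻¹ * ∫ x, llr ν μ x ∂ν := by
        rw [le_inv_mul_iff₀ hs]
        linarith
      exact key.trans (mul_le_mul_of_nonneg_right hsC hH)
  calc transportCost α ν μ ≤ ∫⁻ z, ENNReal.ofReal (α (dist z.1 z.2)) ∂π :=
        sInf_le ⟨π, hπν, hπμ, rfl⟩
    _ ≤ ENNReal.ofReal (C * ∫ x, llr ν μ x ∂ν) := hπ
    _ = _ := ENNReal.ofReal_mul hC.le
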